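/- Let J₋ = diag(−1,1,1,−1) and for t < 0 let α(t) ∈ ℝ⁴ satisfy −α₀(t)² + α₁(t)² + α₂(t)² − α₃(t)² = −1, and define the reflection matrix r_t = Id + 2·J₋·α(t)·α(t)ᵀ. Assume that, as t → 0⁻, α_j(t)/|t| → b_j for j = 0, 1, 2 and α₃(t) → 1. Then τ_t · r_t · τ_t⁻¹ converges, as t → 0⁻, to the 4×4 matrix whose upper-left 3×3 block is the identity, whose entries (0,3), (1,3), (2,3) are 0, and whose last row is (−2b₀, −2b₁, −2b₂, −1). -/

import Mathlib

open Matrix Filter Topology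

/-- The projective rescaling `τ_t = diag(1,1,1,1/|t|)`. -/
noncomputable def tauRescale (t : ℝ) : Matrix (Fin 4) (Fin 4) ℝ :=
  Matrix.diagonal ![1, 1, 1, 1 / |t|]

theorem tauRescale_inv {t : ℝ} (ht : t ≠ 0) :
    (tauRescale t)⁻¹ = Matrix.diagonal ![1, 1, 1, |t|] := by
  have habs : |t| ≠ 0 := abs_ne_zero.mpr ht
  refine Matrix.inv_eq_right_inv ?_
  rw [tauRescale, Matrix.diagonal_mul_diagonal, ← Matrix.diagonal_one]
  congr 1
  funext i
  fin_cases i <;> simp [habs]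

/-- The conjugate by `τ_t` of an anti-de Sitter reflection, in terms of the rescaled normal. -/
theorem tauRescale_mul_reflection_mul_inv {t : ℝ} (ht : t ≠ 0) (a : Fin 4 → ℝ) :
    tauRescale t *
        (1 + (2 : ℝ) • (Matrix.diagonal ![-1, 1, 1, -1] * Matrix.vecMulVec a a)) *
        (tauRescale t)⁻¹ =
      Matrix.of fun i j => (1 : Matrix (Fin 4) (Fin 4) ℝ) i j +
        2 * (![-|t| ^ 2, |t| ^ 2, |t| ^ 2, -1] i *
          (![a 0 / |t|, a 1 / |t|, a 2 / |t|, a 3] i *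
            ![a 0 / |t|, a 1 / |t|, a 2 / |t|, a 3] j)) := by
  have habs : |t| ≠ 0 := abs_ne_zero.mpr ht
  rw [tauRescale_inv ht, tauRescale]
  generalize |t| = s at habs ⊢
  ext i j
  rw [Matrix.mul_diagonal, Matrix.diagonal_mul]
  fin_cases i <;> fin_cases j <;>
    simp [Matrix.diagonal_mul, Matrix.vecMulVec_apply] <;> field_simp

/-- Rescaled limits of anti-de Sitter reflections `r_t = Id + 2 J₋ α(t) α(t)ᵀ` along spacelike
planes whose rescalings converge to a spacelike plane of `HP³` are half-pipe reflections. -/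
theorem rescaled_adS_reflection_tendsto_halfpipe_reflection
    (α : ℝ → Fin 4 → ℝ) (b₀ b₁ b₂ : ℝ)
    (hunit : ∀ t ∈ Set.Iio (0 : ℝ),
      -(α t 0) ^ 2 + (α t 1) ^ 2 + (α t 2) ^ 2 - (α t 3) ^ 2 = -1)
    (h0 : Tendsto (fun t : ℝ => α t 0 / |t|) (nhdsWithin 0 (Set.Iio 0)) (nhds b₀))
    (h1 : Tendsto (fun t : ℝ => α t 1 / |t|) (nhdsWithin 0 (Set.Iio 0)) (nhds b₁))
    (h2 : Tendsto (fun t : ℝ => α t 2 / |t|) (nhdsWithin 0 (Set.Iio 0)) (nhds b₂))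
    (h3 : Tendsto (fun t : ℝ => α t 3) (nhdsWithin 0 (Set.Iio 0)) (nhds 1)) :
    Tendsto
      (fun t : ℝ =>
        tauRescale t *
          (1 + (2 : ℝ) • (Matrix.diagonal ![-1, 1, 1, -1] * Matrix.vecMulVec (α t) (α t))) *
        (tauRescale t)⁻¹)
      (nhdsWithin 0 (Set.Iio 0))
      (nhds !![1, 0, 0, 0;
               0, 1, 0, 0;
               0, 0, 1, 0;
               -2 * b₀, -2 * b₁, -2 * b₂, -1]) := by
  have habs : Tendsto (fun t : ℝ => |t|) (𝓝[<] 0) (𝓝 0) := by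
    simpa using (continuous_abs.tendsto (0 : ℝ)).mono_left nhdsWithin_le_nhds
  have hsq : Tendsto (fun t : ℝ => |t| ^ 2) (𝓝[<] 0) (𝓝 0) := by
    simpa using habs.pow 2
  have hsign (i : Fin 4) :
      Tendsto (fun t : ℝ => ![-|t| ^ 2, |t| ^ 2, |t| ^ 2, -1] i) (𝓝[<] 0)
        (𝓝 (![0, 0, 0, -1] i)) := by
    fin_cases i
    · simpa using hsq.neg
    · exact hsq
    · exact hsq
    · exact tendsto_const_nhds
  have hnormal (i : Fin 4) :
      Tendsto (fun t : ℝ => ![α t 0 / |t|, α t 1 / |t|, α t 2 / |t|, α t 3] i) (𝓝[<] 0)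
        (𝓝 (![b₀, b₁, b₂, 1] i)) := by
    fin_cases i
    exacts [h0, h1, h2, h3]
  refine Tendsto.congr' (eventually_nhdsWithin_of_forall fun t ht =>
    (tauRescale_mul_reflection_mul_inv (ne_of_lt ht) (α t)).symm) ?_
  refine tendsto_pi_nhds.mpr fun i => tendsto_pi_nhds.mpr fun j => ?_
  have h := (((hsign i).mul ((hnormal i).mul (hnormal j))).const_mul 2).const_add
    ((1 : Matrix (Fin 4) (Fin 4) ℝ) i j)
  have hlim : !![1, 0, 0, 0; 0, 1, 0, 0; 0, 0, 1, 0; -2 * b₀, -2 * b₁, -2 * b₂, -1] i j =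
      (1 : Matrix (Fin 4) (Fin 4) ℝ) i j +
        2 * (![0, 0, 0, -1] i * (![b₀, b₁, b₂, 1] i * ![b₀, b₁, b₂, 1] j)) := by
    fin_cases i <;> fin_cases j <;> norm_num
  rw [hlim]
  exact h
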